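/- Let 𝓐 = (A_0, A_1, 𝓕) be a two-phylum algebra with 𝓕 = 𝓖_0 ∪ 𝓖_1 ∪ {h}, where 𝓖_0 consists of operations on A_0 alone, 𝓖_1 consists of operations on A_1 alone, h : A_1 → A_0, 𝓖_0 and 𝓖_1 have the same signature, and h is a homomorphism from 𝓐_1 = (A_1, 𝓖_1) into 𝓐_0 = (A_0, 𝓖_0). Suppose e⃗ ∈ Ω_0, α⃗ ∈ ^ωA_1, and the e⃗-sorted sequence a⃗ is defined by a⃗(i) = α⃗(i) if e⃗(i) = 1 and a⃗(i) = h(α⃗(i)) otherwise. Then: (i) for each N-ary orderly term f ∈ OT(𝓕) with codomain A_0 and all indices n_1 < ⋯ < n_N, there exists an N-ary orderly term F ∈ OT(𝓖_1) such that f(a⃗(n_1), …, a⃗(n_N)) = h(F(α⃗(n_1), …, α⃗(n_N))); and (ii) FR^{e⃗}_𝓕(a⃗) = { h(c) : c ∈ FR_{𝓖_1}(α⃗) }. -/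

import Mathlib

universe u v

/-- A (heterogeneous) operation: a list of input sorts, an output sort, and an
underlying function on lists of elements (only its values on lists of the right
length and sorts matter). -/
structure HetOp (I : Type u) (U : Type v) where
  inSorts : List I
  outSort : I
  fn : List U → U

namespace HetRamsey

variable {I : Type u} {U : Type v}

/-- `f` maps the phyla prescribed by its input sorts into the phylum of its output sort. -/
def WellSorted (A : I → Set U) (f : HetOp I U) : Prop :=
  ∀ xs : List U, List.Forall₂ (fun x ξ => x ∈ A ξ) xs f.inSorts → f.fn xs ∈ A f.outSort

/-- Apply the operations in `hs` to consecutive chunks of the list `xs`. -/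
def applyChunks : List (HetOp I U) → List U → List U
  | [], _ => []
  | h :: t, xs => h.fn (xs.take h.inSorts.length) :: applyChunks t (xs.drop h.inSorts.length)

/-- The orderly terms over a family `F` of operations: `F` itself, the identity
operations, closed under orderly composition. -/
inductive OT (F : Set (HetOp I U)) : HetOp I U → Prop
  | base {f : HetOp I U} : f ∈ F → OT F f
  | id (ξ : I) (c : HetOp I U) :
      c.inSorts = [ξ] → c.outSort = ξ → (∀ x : U, c.fn [x] = x) → OT F c
  | comp (g : HetOp I U) (hs : List (HetOp I U)) :
      g ∈ F → (∀ h ∈ hs, OT F h) →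
      List.Forall₂ (fun (h : HetOp I U) ξ => h.outSort = ξ) hs g.inSorts →
      OT F ⟨(hs.map HetOp.inSorts).flatten, g.outSort, fun xs => g.fn (applyChunks hs xs)⟩

/-- `b` is `e`-sorted: the `i`-th term lies in phylum `A (e i)`. -/
def Sorted (A : I → Set U) (e : ℕ → I) (b : ℕ → U) : Prop :=
  ∀ i, b i ∈ A (e i)

/-- `a` is a reduction of `b` with respect to the family of operations `F`:
each term `a j` is obtained by applying an orderly term over `F` to a finite
subsequence of `b`, and these finite subsequences concatenate to a
subsequence of `b`. -/
def Reduction (A : I → Set U) (F : Set (HetOp I U)) (a b : ℕ → U) : Prop :=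
  ∃ (φ : ℕ → List ℕ) (f : ℕ → HetOp I U),
    (∀ j, OT F (f j)) ∧
    (∀ j, (φ j).Chain' (· < ·)) ∧
    (∀ j k, j < k → ∀ x ∈ φ j, ∀ y ∈ φ k, x < y) ∧
    (∀ j, List.Forall₂ (fun i ξ => b i ∈ A ξ) (φ j) (f j).inSorts) ∧
    (∀ j, a j = (f j).fn ((φ j).map b))

/-- `FR^e_F(b)`: the set of first terms of `e`-sorted reductions of `b`. -/
def FR (A : I → Set U) (F : Set (HetOp I U)) (e : ℕ → I) (b : ℕ → U) : Set U :=
  { x | ∃ a : ℕ → U, Reduction A F a b ∧ Sorted A e a ∧ a 0 = x }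

/-- The algebra with phyla `A` and operations `F` is an `e`-Ramsey algebra. -/
def IsERamsey (A : I → Set U) (F : Set (HetOp I U)) (e : ℕ → I) : Prop :=
  ∀ b : ℕ → U, Sorted A e b → ∀ X : Set U, X ⊆ A (e 0) →
    ∃ a : ℕ → U, Reduction A F a b ∧ Sorted A e a ∧
      (FR A F e a ⊆ X ∨ FR A F e a ∩ X = ∅)

/-- The homogeneous algebra `(A ξ, F)` is a Ramsey algebra: it is `e`-Ramsey for
the constant sort with value `ξ`. -/
def IsRamsey (A : I → Set U) (F : Set (HetOp I U)) (ξ : I) : Prop :=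
  IsERamsey A F fun _ => ξ

/-- For a homogeneous algebra: `FR_G(α) = { f(τ) : f ∈ OT(G), τ a finite subsequence of α }`. -/
def FRfin (A : I → Set U) (G : Set (HetOp I U)) (α : ℕ → U) : Set U :=
  { x | ∃ (f : HetOp I U) (ns : List ℕ), OT G f ∧ ns.Chain' (· < ·) ∧
      List.Forall₂ (fun i ξ => α i ∈ A ξ) ns f.inSorts ∧ x = f.fn (ns.map α) }

/-- `e ∈ Ω`: every value attained by the sort `e` is attained infinitely often. -/
def InOmega (e : ℕ → I) : Prop :=
  ∀ i, {j | e j = e i}.Infinite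

end HetRamsey

open HetRamsey

namespace HetRamsey

section Chunks

variable {I : Type u} {U : Type v}

/-- The orderly composition of `g` with the operations in `hs`. -/
def orderlyComp (g : HetOp I U) (hs : List (HetOp I U)) : HetOp I U :=
  ⟨(hs.map HetOp.inSorts).flatten, g.outSort, fun xs => g.fn (applyChunks hs xs)⟩

/-- The identity operation of sort `ξ`, with value `d` on the empty list. -/
def idOp (d : U) (ξ : I) : HetOp I U :=
  ⟨[ξ], ξ, fun xs => xs.headD d⟩

theorem OT.identity (F : Set (HetOp I U)) (d : U) (ξ : I) : OT F (idOp d ξ) :=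
  OT.id ξ _ rfl rfl fun _ => rfl

theorem length_applyChunks (hs : List (HetOp I U)) (xs : List U) :
    (applyChunks hs xs).length = hs.length := by
  induction hs generalizing xs with
  | nil => rfl
  | cons h t ih => simp [applyChunks, ih]

theorem applyChunks_replicate_idOp (d : U) (ξ : I) (xs : List U) :
    applyChunks (List.replicate xs.length (idOp d ξ)) xs = xs := by
  induction xs with
  | nil => rfl
  | cons x t ih => simp [List.replicate_succ, applyChunks, idOp] at ih ⊢; exact ih

end Chunks

section Lift

variable {U : Type v}

/-- The identity on sort `1` and `h` on sort `0`. -/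
def toSort (h : U → U) (ξ : Fin 2) (x : U) : U :=
  if ξ = 1 then x else h x

/-- `F` maps lists over `S` into `S`, and `f` applied to the images of such a list under
`toSort h` is the image of the value of `F`. -/
structure IsLift (h : U → U) (S : Set U) (f F : HetOp (Fin 2) U) : Prop where
  length_eq : F.inSorts.length = f.inSorts.length
  mem : ∀ xs : List U, xs.length = f.inSorts.length → (∀ x ∈ xs, x ∈ S) → F.fn xs ∈ S
  fn_eq : ∀ xs : List U, xs.length = f.inSorts.length → (∀ x ∈ xs, x ∈ S) →
    f.fn (List.zipWith (toSort h) f.inSorts xs) = toSort h f.outSort (F.fn xs)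

variable {h : U → U} {S : Set U}

theorem IsLift.congr {f F F' : HetOp (Fin 2) U} (hF : IsLift h S f F)
    (hlen : F'.inSorts.length = F.inSorts.length)
    (hfn : ∀ xs : List U, xs.length = F.inSorts.length → F'.fn xs = F.fn xs) :
    IsLift h S f F' where
  length_eq := hlen.trans hF.length_eq
  mem xs hx hS := by
    rw [hfn xs (hx.trans hF.length_eq.symm)]
    exact hF.mem xs hx hS
  fn_eq xs hx hS := by
    rw [hfn xs (hx.trans hF.length_eq.symm)]
    exact hF.fn_eq xs hx hS

theorem IsLift.chunks {fs Fs : List (HetOp (Fin 2) U)}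
    (hl : List.Forall₂ (IsLift h S) fs Fs) :
    ∀ xs : List U, xs.length = (fs.map HetOp.inSorts).flatten.length → (∀ x ∈ xs, x ∈ S) →
      (∀ y ∈ applyChunks Fs xs, y ∈ S) ∧
      applyChunks fs (List.zipWith (toSort h) (fs.map HetOp.inSorts).flatten xs) =
        List.zipWith (toSort h) (fs.map HetOp.outSort) (applyChunks Fs xs) := by
  induction hl with
  | nil => intro xs _ _; simp [applyChunks]
  | @cons f F fs Fs hf _ ih =>
    intro xs hx hS
    simp only [List.map_cons, List.flatten_cons, List.length_append] at hx
    have htake : (xs.take f.inSorts.length).length = f.inSorts.length := by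
      simp [hx]
    have htakeS : ∀ x ∈ xs.take f.inSorts.length, x ∈ S :=
      fun x hxm => hS x (List.mem_of_mem_take hxm)
    obtain ⟨ih₁, ih₂⟩ := ih (xs.drop f.inSorts.length) (by simp [hx])
      fun x hxm => hS x (List.mem_of_mem_drop hxm)
    have hzip : List.zipWith (toSort h) (f.inSorts ++ (fs.map HetOp.inSorts).flatten) xs =
        List.zipWith (toSort h) f.inSorts (xs.take f.inSorts.length) ++
        List.zipWith (toSort h) (fs.map HetOp.inSorts).flatten (xs.drop f.inSorts.length) := by
      rw [← List.zipWith_append htake.symm, List.take_append_drop]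
    have hlen : (List.zipWith (toSort h) f.inSorts (xs.take f.inSorts.length)).length =
        f.inSorts.length := by
      rw [List.length_zipWith, htake, min_self]
    constructor
    · simp only [applyChunks, hf.length_eq, List.mem_cons, forall_eq_or_imp]
      exact ⟨hf.mem _ htake htakeS, ih₁⟩
    · simp only [applyChunks, hf.length_eq, List.map_cons, List.flatten_cons, hzip,
        List.zipWith_cons_cons, List.take_left' hlen, List.drop_left' hlen, ih₂,
        hf.fn_eq _ htake htakeS]

theorem IsLift.composition {g G : HetOp (Fin 2) U} (hg : IsLift h S g G)
    {fs Fs : List (HetOp (Fin 2) U)} (hl : List.Forall₂ (IsLift h S) fs Fs)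
    (hout : fs.map HetOp.outSort = g.inSorts) :
    IsLift h S (orderlyComp g fs) (orderlyComp G Fs) := by
  have hlen (xs : List U) : (applyChunks Fs xs).length = g.inSorts.length := by
    rw [length_applyChunks, ← hl.length_eq, ← hout, List.length_map]
  refine ⟨?_, fun xs hx hS => ?_, fun xs hx hS => ?_⟩
  · clear hlen hout
    simp only [orderlyComp]
    induction hl with
    | nil => rfl
    | cons hf _ ih => simp only [List.map_cons, List.flatten_cons, List.length_append, ih,
        hf.length_eq]
  · exact hg.mem _ (hlen xs) (IsLift.chunks hl xs hx hS).1
  · simp only [orderlyComp]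
    rw [(IsLift.chunks hl xs hx hS).2, hout]
    exact hg.fn_eq _ (hlen xs) (IsLift.chunks hl xs hx hS).1

theorem isLift_of_forall_eq {c : HetOp (Fin 2) U} {ξ : Fin 2} (hin : c.inSorts = [ξ])
    (hc : ∀ x : U, c.fn [toSort h ξ x] = toSort h c.outSort x) (d : U) :
    IsLift h S c (idOp d 1) := by
  refine ⟨by simp [idOp, hin], fun xs hx hS => ?_, fun xs hx hS => ?_⟩
  all_goals
    rw [hin, List.length_singleton, List.length_eq_one_iff] at hx
    obtain ⟨x, rfl⟩ := hx
  · simpa [idOp] using hS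
  · simpa [idOp, hin] using hc x

theorem zipWith_toSort_replicate_one (xs : List U) :
    List.zipWith (toSort h) (List.replicate xs.length 1) xs = xs := by
  induction xs with
  | nil => rfl
  | cons x t ih => simp [List.replicate_succ, toSort] at ih ⊢; exact ih

theorem zipWith_toSort_replicate_zero (xs : List U) :
    List.zipWith (toSort h) (List.replicate xs.length 0) xs = xs.map h := by
  induction xs with
  | nil => rfl
  | cons x t ih => simp [List.replicate_succ, toSort] at ih ⊢; exact ih

theorem forall₂_mem_replicate {A : Fin 2 → Set U} {ξ : Fin 2} {xs : List U} {n : ℕ}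
    (hx : xs.length = n) (hS : ∀ x ∈ xs, x ∈ A ξ) :
    List.Forall₂ (fun x ξ => x ∈ A ξ) xs (List.replicate n ξ) := by
  subst hx
  induction xs with
  | nil => exact .nil
  | cons x t ih =>
    simp only [List.mem_cons, forall_eq_or_imp] at hS
    exact .cons hS.1 (ih hS.2)

end Lift

section Hom

variable {U : Type v} {A : Fin 2 → Set U} {G0 G1 : Set (HetOp (Fin 2) U)}
  {hOp : HetOp (Fin 2) U} {T : HetOp (Fin 2) U → HetOp (Fin 2) U}

theorem isLift_self (hG1 : ∀ f ∈ G1, f.outSort = 1 ∧ (∀ ξ ∈ f.inSorts, ξ = 1) ∧ WellSorted A f)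
    (h : U → U) {F : HetOp (Fin 2) U} (hF : F ∈ G1) : IsLift h (A 1) F F := by
  obtain ⟨hout, hin, hws⟩ := hG1 F hF
  have hrep := List.eq_replicate_of_mem hin
  refine ⟨rfl, fun xs hx hS => ?_, fun xs hx hS => ?_⟩
  · rw [← hout]
    refine hws xs ?_
    rw [hrep]
    exact forall₂_mem_replicate hx hS
  · rw [hrep, ← hx, zipWith_toSort_replicate_one, hout]
    simp [toSort]

theorem isLift_hom
    (hG0 : ∀ f ∈ G0, f.outSort = 0 ∧ (∀ ξ ∈ f.inSorts, ξ = 0) ∧ WellSorted A f)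
    (hG1 : ∀ f ∈ G1, f.outSort = 1 ∧ (∀ ξ ∈ f.inSorts, ξ = 1) ∧ WellSorted A f)
    (hT : Set.MapsTo T G1 G0)
    (hTarity : ∀ F ∈ G1, (T F).inSorts.length = F.inSorts.length)
    (hhom : ∀ F ∈ G1, ∀ xs : List U,
        List.Forall₂ (fun x ξ => x ∈ A ξ) xs F.inSorts →
        hOp.fn [F.fn xs] = (T F).fn (xs.map fun x => hOp.fn [x]))
    {F : HetOp (Fin 2) U} (hF : F ∈ G1) :
    IsLift (fun x => hOp.fn [x]) (A 1) (T F) F := by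
  obtain ⟨hout, hin, -⟩ := hG0 _ (hT hF)
  have hrep := List.eq_replicate_of_mem hin
  refine ⟨(hTarity F hF).symm, fun xs hx hS => ?_, fun xs hx hS => ?_⟩
  · exact (isLift_self hG1 id hF).mem xs (hx.trans (hTarity F hF)) hS
  · rw [hrep, ← hx, zipWith_toSort_replicate_zero, hout, ← hhom F hF]
    · simp [toSort]
    · rw [List.eq_replicate_of_mem (hG1 F hF).2.1]
      exact forall₂_mem_replicate (hx.trans (hTarity F hF)) hS

theorem OT.composition {I : Type u} {F : Set (HetOp I U)} {g : HetOp I U}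
    {hs : List (HetOp I U)} (hg : g ∈ F)
    (hhs : ∀ h ∈ hs, OT F h) (hout : hs.map HetOp.outSort = g.inSorts) :
    OT F (orderlyComp g hs) :=
  OT.comp g hs hg hhs <| by
    rw [← hout, List.forall₂_map_right_iff]
    exact List.forall₂_same.2 fun _ _ => rfl

theorem isLift_hOp (hin : hOp.inSorts = [1]) (hout : hOp.outSort = 0) (S : Set U) (d : U) :
    IsLift (fun x => hOp.fn [x]) S hOp (idOp d 1) :=
  isLift_of_forall_eq hin (fun x => by simp [hout, toSort]) d

theorem OT.exists_isLift
    (hG0 : ∀ f ∈ G0, f.outSort = 0 ∧ (∀ ξ ∈ f.inSorts, ξ = 0) ∧ WellSorted A f)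
    (hG1 : ∀ f ∈ G1, f.outSort = 1 ∧ (∀ ξ ∈ f.inSorts, ξ = 1) ∧ WellSorted A f)
    (hin : hOp.inSorts = [1]) (hout : hOp.outSort = 0)
    (hT : Set.BijOn T G1 G0)
    (hTarity : ∀ F ∈ G1, (T F).inSorts.length = F.inSorts.length)
    (hhom : ∀ F ∈ G1, ∀ xs : List U,
        List.Forall₂ (fun x ξ => x ∈ A ξ) xs F.inSorts →
        hOp.fn [F.fn xs] = (T F).fn (xs.map fun x => hOp.fn [x]))
    (d : U) {f : HetOp (Fin 2) U} (hf : OT (G0 ∪ G1 ∪ {hOp}) f) :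
    ∃ F, OT G1 F ∧ F.outSort = 1 ∧ (∀ ξ ∈ F.inSorts, ξ = 1) ∧
      IsLift (fun x => hOp.fn [x]) (A 1) f F := by
  have hbase : ∀ g ∈ G0 ∪ G1, ∃ G ∈ G1, IsLift (fun x => hOp.fn [x]) (A 1) g G := by
    rintro g (hg | hg)
    · obtain ⟨G, hG, rfl⟩ := hT.surjOn hg
      exact ⟨G, hG, isLift_hom hG0 hG1 hT.mapsTo hTarity hhom hG⟩
    · exact ⟨g, hg, isLift_self hG1 _ hg⟩
  induction hf with
  | @base f hf =>
    rcases hf with hf | rfl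
    · obtain ⟨F, hF, hl⟩ := hbase f hf
      exact ⟨F, .base hF, (hG1 F hF).1, (hG1 F hF).2.1, hl⟩
    · exact ⟨idOp d 1, .identity _ d 1, rfl, by simp [idOp], isLift_hOp hin hout _ d⟩
  | id ξ c hc hc' hfn =>
    exact ⟨idOp d 1, .identity _ d 1, rfl, by simp [idOp],
      isLift_of_forall_eq hc (fun x => by rw [hfn, hc']) d⟩
  | comp g hs hg _ hsort ih =>
    have hsort' : hs.map HetOp.outSort = g.inSorts := by
      rw [← List.forall₂_eq_eq_eq, List.forall₂_map_left_iff]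
      exact hsort
    rcases hg with hg | rfl
    · obtain ⟨G, hG, hl⟩ := hbase g hg
      have : Nonempty (HetOp (Fin 2) U) := ⟨g⟩
      choose! L hLOT hLout hLin hL using ih
      refine ⟨orderlyComp G (hs.map L), .composition hG ?_ ?_, (hG1 G hG).1, ?_, ?_⟩
      · simpa using hLOT
      · rw [List.eq_replicate_of_mem (hG1 G hG).2.1, List.eq_replicate_iff, hl.length_eq]
        constructor
        · simp [← hsort']
        · simpa using hLout
      · simp only [orderlyComp, List.mem_flatten, List.mem_map]
        rintro ξ ⟨_, ⟨_, ⟨k, hk, rfl⟩, rfl⟩, hξ⟩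
        exact hLin k hk ξ hξ
      · refine hl.composition ?_ hsort'
        rw [List.forall₂_map_right_iff]
        exact List.forall₂_same.2 hL
    · rw [hin] at hsort'
      obtain ⟨k, rfl⟩ : ∃ k, hs = [k] := by
        rw [← List.length_eq_one_iff, ← List.length_map (f := HetOp.outSort), hsort']
        rfl
      obtain ⟨K, hK, hKout, hKin, hlK⟩ := ih k (by simp)
      refine ⟨K, hK, hKout, hKin, ?_⟩
      refine ((isLift_hOp hin hout _ d).composition (fs := [k]) (Fs := [K])
        (.cons hlK .nil) (by rw [hin, hsort'])).congr (by simp [orderlyComp]) ?_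
      intro xs hx
      simp only [orderlyComp, List.map_cons, List.map_nil, List.flatten_cons,
        List.flatten_nil, List.append_nil] at hx
      simp [orderlyComp, applyChunks, idOp, ← hx]

theorem exists_forall₂_isLift {𝓕 : Set (HetOp (Fin 2) U)} {h : U → U} {S : Set U}
    {Fs : List (HetOp (Fin 2) U)}
    (hFs : ∀ F ∈ Fs, ∀ σ : List (Fin 2), σ.length = F.inSorts.length →
      ∃ f, OT 𝓕 f ∧ f.inSorts = σ ∧ f.outSort = 0 ∧ IsLift h S f F) :
    ∀ σ : List (Fin 2), σ.length = (Fs.map HetOp.inSorts).flatten.length →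
      ∃ fs, (∀ f ∈ fs, OT 𝓕 f) ∧ (fs.map HetOp.inSorts).flatten = σ ∧
        (∀ f ∈ fs, f.outSort = 0) ∧ List.Forall₂ (IsLift h S) fs Fs := by
  induction Fs with
  | nil =>
    intro σ hσ
    refine ⟨[], by simp, ?_, by simp, .nil⟩
    exact (List.length_eq_zero_iff.1 (by simpa using hσ)).symm
  | cons F Fs ih =>
    intro σ hσ
    simp only [List.mem_cons, forall_eq_or_imp] at hFs
    simp only [List.map_cons, List.flatten_cons, List.length_append] at hσ
    obtain ⟨f, hf, hfin, hfout, hl⟩ := hFs.1 (σ.take F.inSorts.length) (by simp [hσ])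
    obtain ⟨fs, hfs, hfsin, hfsout, hls⟩ := ih hFs.2 (σ.drop F.inSorts.length) (by simp [hσ])
    refine ⟨f :: fs, ?_, ?_, ?_, .cons hl hls⟩
    · simpa using ⟨hf, hfs⟩
    · simp [hfin, hfsin]
    · simpa using ⟨hfout, hfsout⟩

theorem OT.exists_isLift_of_inSorts
    (hG0 : ∀ f ∈ G0, f.outSort = 0 ∧ (∀ ξ ∈ f.inSorts, ξ = 0) ∧ WellSorted A f)
    (hG1 : ∀ f ∈ G1, f.outSort = 1 ∧ (∀ ξ ∈ f.inSorts, ξ = 1) ∧ WellSorted A f)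
    (hin : hOp.inSorts = [1]) (hout : hOp.outSort = 0)
    (hT : Set.MapsTo T G1 G0)
    (hTarity : ∀ F ∈ G1, (T F).inSorts.length = F.inSorts.length)
    (hhom : ∀ F ∈ G1, ∀ xs : List U,
        List.Forall₂ (fun x ξ => x ∈ A ξ) xs F.inSorts →
        hOp.fn [F.fn xs] = (T F).fn (xs.map fun x => hOp.fn [x]))
    (d : U) {F : HetOp (Fin 2) U} (hF : OT G1 F) (σ : List (Fin 2))
    (hσ : σ.length = F.inSorts.length) (hFout : F.outSort = 1) :
    ∃ f, OT (G0 ∪ G1 ∪ {hOp}) f ∧ f.inSorts = σ ∧ f.outSort = 0 ∧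
      IsLift (fun x => hOp.fn [x]) (A 1) f F := by
  have hid : ∀ σ : List (Fin 2), σ.length = 1 →
      ∃ f, OT (G0 ∪ G1 ∪ {hOp}) f ∧ f.inSorts = σ ∧ f.outSort = 0 ∧
        IsLift (fun x => hOp.fn [x]) (A 1) f (idOp d 1) := by
    intro σ hσ
    obtain ⟨ξ, rfl⟩ := List.length_eq_one_iff.1 hσ
    by_cases hξ : ξ = 1
    · subst hξ
      exact ⟨hOp, .base (Or.inr rfl), hin, hout, isLift_hOp hin hout _ d⟩
    · obtain rfl : ξ = 0 := by omega
      exact ⟨idOp d 0, .identity _ d 0, rfl, rfl, isLift_of_forall_eq rfl (fun x => rfl) d⟩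
  have hcomp : ∀ G ∈ G1, ∀ Fs : List (HetOp (Fin 2) U), Fs.length = G.inSorts.length →
      (∀ F ∈ Fs, ∀ σ : List (Fin 2), σ.length = F.inSorts.length →
        ∃ f, OT (G0 ∪ G1 ∪ {hOp}) f ∧ f.inSorts = σ ∧ f.outSort = 0 ∧
          IsLift (fun x => hOp.fn [x]) (A 1) f F) →
      ∀ σ : List (Fin 2), σ.length = (Fs.map HetOp.inSorts).flatten.length →
        ∃ f, OT (G0 ∪ G1 ∪ {hOp}) f ∧ f.inSorts = σ ∧ f.outSort = 0 ∧
          IsLift (fun x => hOp.fn [x]) (A 1) f (orderlyComp G Fs) := by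
    intro G hG Fs hlen hFs σ hσ
    obtain ⟨fs, hfs, hfsin, hfsout, hls⟩ := exists_forall₂_isLift hFs σ hσ
    have hsort : fs.map HetOp.outSort = (T G).inSorts := by
      rw [List.eq_replicate_of_mem (hG0 _ (hT hG)).2.1, List.eq_replicate_iff]
      constructor
      · rw [List.length_map, hls.length_eq, hlen, hTarity G hG]
      · simpa using hfsout
    exact ⟨orderlyComp (T G) fs, .composition (Or.inl (Or.inl (hT hG))) hfs hsort, hfsin,
      (hG0 _ (hT hG)).1,
      (isLift_hom hG0 hG1 hT hTarity hhom hG).composition hls hsort⟩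
  induction hF generalizing σ with
  | @base F hF =>
    obtain ⟨f, hf, hfin, hfout, hl⟩ := hcomp F hF
      (List.replicate F.inSorts.length (idOp d 1)) (by simp)
      (fun k hk => by rw [List.eq_of_mem_replicate hk]; exact hid) σ
      (by simp [idOp, hσ])
    refine ⟨f, hf, hfin, hfout, hl.congr (by simp [orderlyComp, idOp]) ?_⟩
    intro xs hx
    have hx' : xs.length = F.inSorts.length := by
      simpa [orderlyComp, idOp] using hx
    simp only [orderlyComp]
    rw [← hx', applyChunks_replicate_idOp]
  | id ξ c hc hc' hfn =>
    obtain ⟨f, hf, hfin, hfout, hl⟩ := hid σ (by simpa [hc] using hσ)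
    refine ⟨f, hf, hfin, hfout, hl.congr (by simp [idOp, hc]) ?_⟩
    intro xs hx
    obtain ⟨x, rfl⟩ := List.length_eq_one_iff.1 hx
    simp [hfn, idOp]
  | comp g hs hg _ hsort ih =>
    refine hcomp g hg hs hsort.length_eq (fun k hk τ hτ => ih k hk τ hτ ?_) σ hσ
    have hsort' : hs.map HetOp.outSort = g.inSorts := by
      rw [← List.forall₂_eq_eq_eq, List.forall₂_map_left_iff]
      exact hsort
    exact (hG1 g hg).2.1 _ (hsort' ▸ List.mem_map_of_mem hk)

end Hom

section Sequences

variable {U : Type v} {A : Fin 2 → Set U} {e : ℕ → Fin 2} {a α : ℕ → U}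

theorem Sorted.forall₂_mem_iff (hdisj : Pairwise fun ξ η => Disjoint (A ξ) (A η))
    (ha : Sorted A e a) {ns : List ℕ} {σ : List (Fin 2)} :
    List.Forall₂ (fun i ξ => a i ∈ A ξ) ns σ ↔ σ = ns.map e := by
  have hiff : ∀ i ξ, a i ∈ A ξ ↔ e i = ξ := fun i ξ =>
    ⟨fun h => by_contra fun hne => Set.disjoint_left.1 (hdisj hne) (ha i) h, fun h => h ▸ ha i⟩
  simp only [hiff]
  rw [← List.forall₂_map_left_iff (f := e) (R := fun x y => x = y), List.forall₂_eq_eq_eq, eq_comm]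

/-- Beyond any bound, a sort in `Ω` has a subsequence equal to its tail. -/
theorem InOmega.exists_strictMono (he : InOmega e) (m : ℕ) :
    ∃ n : ℕ → ℕ, StrictMono n ∧ (∀ j, m < n j) ∧ ∀ j, e (n j) = e (j + 1) := by
  have hex : ∀ j b : ℕ, ∃ k, b < k ∧ e k = e (j + 1) := fun j b => by
    obtain ⟨k, hk, hb⟩ := (he (j + 1)).exists_gt b
    exact ⟨k, hb, hk⟩
  choose next hlt hnext using hex
  let n : ℕ → ℕ := fun j => Nat.rec (next 0 m) (fun j b => next (j + 1) b) j
  have hmono : StrictMono n := strictMono_nat_of_lt_succ fun j => hlt (j + 1) (n j)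
  refine ⟨n, hmono, fun j => (hlt 0 m).trans_le (hmono.monotone (Nat.zero_le j)), fun j => ?_⟩
  cases j with
  | zero => exact hnext 0 m
  | succ j => exact hnext (j + 1) (n j)

theorem mem_FR_of_OT {𝓕 : Set (HetOp (Fin 2) U)} (he : InOmega e) (ha : Sorted A e a)
    {f : HetOp (Fin 2) U} (hf : OT 𝓕 f) {ns : List ℕ} (hns : ns.IsChain (· < ·))
    (hin : f.inSorts = ns.map e) (hmem : f.fn (ns.map a) ∈ A (e 0)) :
    f.fn (ns.map a) ∈ FR A 𝓕 e a := by
  obtain ⟨n, hmono, hgt, hn⟩ := he.exists_strictMono ns.sum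
  refine ⟨fun j => j.casesOn (f.fn (ns.map a)) fun j => a (n j),
    ⟨fun j => j.casesOn ns fun j => [n j],
      fun j => j.casesOn f fun j => idOp (a 0) (e (j + 1)), ?_, ?_, ?_, ?_, ?_⟩, ?_, rfl⟩
  · rintro (_ | j)
    · exact hf
    · exact .identity _ _ _
  · rintro (_ | j)
    · exact hns
    · exact List.isChain_singleton _
  · rintro (_ | j) (_ | k) hjk x hx y hy
    · omega
    · obtain rfl := List.mem_singleton.1 hy
      exact (List.le_sum_of_mem hx).trans_lt (hgt k)
    · omega
    · obtain rfl := List.mem_singleton.1 hx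
      obtain rfl := List.mem_singleton.1 hy
      exact hmono (by omega)
  · rintro (_ | j)
    · change List.Forall₂ _ ns f.inSorts
      rw [hin, List.forall₂_map_right_iff]
      exact List.forall₂_same.2 fun i _ => ha i
    · refine .cons ?_ .nil
      rw [← hn j]
      exact ha _
  · rintro (_ | j) <;> rfl
  · rintro (_ | j)
    · exact hmem
    · change a (n j) ∈ A (e (j + 1))
      rw [← hn j]
      exact ha _

end Sequences

end HetRamsey

/-- Lemma on homomorphisms: let `(A 0, A 1, 𝓖₀ ∪ 𝓖₁ ∪ {h})` be a
two-phylum algebra where `𝓖₀` and `𝓖₁` have the same signature (witnessed by the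
arity-preserving bijection `T : 𝓖₁ → 𝓖₀`) and `h : A 1 → A 0` is a homomorphism.
Let `e ∈ Ω₀`, `α⃗ ∈ ^ω(A 1)`, and let `a⃗` be the `e`-sorted sequence with
`a i = α i` if `e i = 1` and `a i = h (α i)` otherwise. Then (i) every orderly
term over `𝓕` with codomain `A 0`, applied to terms of `a⃗`, equals `h` of some
orderly term over `𝓖₁` of the same arity applied to the corresponding terms of
`α⃗`; and (ii) `FR^e_𝓕(a⃗) = h '' FR_{𝓖₁}(α⃗)`. -/
theorem orderlyTerm_factors_through_hom_and_FR_eq_image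
    {U : Type v}
    (A : Fin 2 → Set U) (G0 G1 : Set (HetOp (Fin 2) U)) (hOp : HetOp (Fin 2) U)
    (hne : ∀ ξ, (A ξ).Nonempty)
    (hdisj : Pairwise fun ξ η => Disjoint (A ξ) (A η))
    (hG0 : ∀ f ∈ G0, f.outSort = 0 ∧ (∀ ξ ∈ f.inSorts, ξ = 0) ∧ WellSorted A f)
    (hG1 : ∀ f ∈ G1, f.outSort = 1 ∧ (∀ ξ ∈ f.inSorts, ξ = 1) ∧ WellSorted A f)
    (hin : hOp.inSorts = [1]) (hout : hOp.outSort = 0) (hws : WellSorted A hOp)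
    -- `𝓖₀` and `𝓖₁` have the same signature, via the arity-preserving bijection `T`
    (T : HetOp (Fin 2) U → HetOp (Fin 2) U)
    (hT : Set.BijOn T G1 G0)
    (hTarity : ∀ F ∈ G1, (T F).inSorts.length = F.inSorts.length)
    -- `h` is a homomorphism from `(A 1, 𝓖₁)` into `(A 0, 𝓖₀)`
    (hhom : ∀ F ∈ G1, ∀ xs : List U,
        List.Forall₂ (fun x ξ => x ∈ A ξ) xs F.inSorts →
        hOp.fn [F.fn xs] = (T F).fn (xs.map fun x => hOp.fn [x]))
    (e : ℕ → Fin 2) (he : InOmega e) (he0 : e 0 = 0)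
    (α : ℕ → U) (hα : ∀ i, α i ∈ A 1)
    (a : ℕ → U) (ha : ∀ i, a i = if e i = 1 then α i else hOp.fn [α i]) :
    (∀ f : HetOp (Fin 2) U, OT (G0 ∪ G1 ∪ {hOp}) f → f.outSort = 0 →
      ∀ ns : List ℕ, ns.Chain' (· < ·) →
        List.Forall₂ (fun i ξ => a i ∈ A ξ) ns f.inSorts →
        ∃ F : HetOp (Fin 2) U, OT G1 F ∧ F.inSorts.length = ns.length ∧
          f.fn (ns.map a) = hOp.fn [F.fn (ns.map α)]) ∧
    FR A (G0 ∪ G1 ∪ {hOp}) e a = (fun c => hOp.fn [c]) '' FRfin A G1 α := by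
  have hsorted : Sorted A e a := fun i => by
    rw [ha i]
    split_ifs with hi
    · rw [hi]; exact hα i
    · rw [show e i = 0 by omega, ← hout]
      exact hws _ (by rw [hin]; exact .cons (hα i) .nil)
  have hαsorted : Sorted A (fun _ => 1) α := hα
  have hzip : ∀ ns : List ℕ,
      List.zipWith (toSort fun x => hOp.fn [x]) (ns.map e) (ns.map α) = ns.map a := by
    intro ns
    rw [List.zipWith_map, List.zipWith_self]
    exact List.map_congr_left fun i _ => (ha i).symm
  have hαmem : ∀ ns : List ℕ, ∀ x ∈ ns.map α, x ∈ A 1 := by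
    intro ns x hx
    obtain ⟨i, -, rfl⟩ := List.mem_map.1 hx
    exact hα i
  have hlift : ∀ {f F : HetOp (Fin 2) U}, IsLift (fun x => hOp.fn [x]) (A 1) f F →
      ∀ {ns : List ℕ}, f.inSorts = ns.map e →
        F.fn (ns.map α) ∈ A 1 ∧
        f.fn (ns.map a) = toSort (fun x => hOp.fn [x]) f.outSort (F.fn (ns.map α)) := by
    intro f F hl ns hns
    refine ⟨hl.mem _ (by simp [hns]) (hαmem ns), ?_⟩
    rw [← hl.fn_eq _ (by simp [hns]) (hαmem ns), hns, hzip]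
  have hmem0 : ∀ {c : U}, c ∈ A 1 → hOp.fn [c] ∈ A 0 := fun hc => by
    rw [← hout]
    exact hws _ (by rw [hin]; exact .cons hc .nil)
  refine ⟨fun f hf hfout ns _ hns => ?_, Set.Subset.antisymm ?_ ?_⟩
  · rw [hsorted.forall₂_mem_iff hdisj] at hns
    obtain ⟨F, hF, -, -, hl⟩ := hf.exists_isLift hG0 hG1 hin hout hT hTarity hhom (α 0)
    refine ⟨F, hF, by simp [hl.length_eq, hns], ?_⟩
    rw [(hlift hl hns).2, hfout]
    rfl
  · rintro _ ⟨b, ⟨φ, f, hf, hφ, -, hφf, hb⟩, hbs, rfl⟩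
    have hns := (hsorted.forall₂_mem_iff hdisj).1 (hφf 0)
    obtain ⟨F, hF, -, hFin, hl⟩ := (hf 0).exists_isLift hG0 hG1 hin hout hT hTarity hhom (α 0)
    obtain ⟨hFmem, hval⟩ := hlift hl hns
    refine ⟨F.fn ((φ 0).map α), ⟨F, φ 0, hF, hφ 0, ?_, rfl⟩, ?_⟩
    · rw [hαsorted.forall₂_mem_iff hdisj, List.eq_replicate_of_mem hFin, hl.length_eq, hns]
      simp
    · have hb0 : b 0 ∈ A 0 := he0 ▸ hbs 0
      have hne1 : (f 0).outSort ≠ 1 := fun h1 => by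
        rw [hb 0, hval, h1] at hb0
        exact Set.disjoint_left.1 (hdisj zero_ne_one) hb0 hFmem
      rw [hb 0, hval, toSort, if_neg hne1]
  · rintro _ ⟨_, ⟨F, ns, hF, hns, hFns, rfl⟩, rfl⟩
    have hFin := (hαsorted.forall₂_mem_iff hdisj).1 hFns
    have hFout : F.outSort = 1 := by
      cases hF with
      | base h => exact (hG1 F h).1
      | id ξ _ h h' _ =>
        rw [h']
        have : ξ ∈ F.inSorts := by simp [h]
        rw [hFin] at this
        simpa using (List.mem_map.1 this).choose_spec.2.symm
      | comp g hs h _ _ => exact (hG1 g h).1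
    obtain ⟨f, hf, hfin, hfout, hl⟩ := hF.exists_isLift_of_inSorts hG0 hG1 hin hout hT.mapsTo
      hTarity hhom (α 0) (ns.map e) (by simp [hFin]) hFout
    obtain ⟨hFmem, hval⟩ := hlift hl hfin
    rw [hfout] at hval
    change hOp.fn [F.fn (ns.map α)] ∈ _
    rw [show hOp.fn [F.fn (ns.map α)] = f.fn (ns.map a) from hval.symm]
    refine mem_FR_of_OT he hsorted hf hns hfin ?_
    rw [hval, he0]
    exact hmem0 hFmem
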